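/- Let v : Ω̄×[0,T] → ℝ² be smooth. Then there exist constants c₁, c₂ > 0 depending only on Ω, C₁, C₂ such that ‖D²v(t)‖_{L^∞(Ω)} ≤ c₁‖v(t)‖_{H⁴(Ω)} ≤ c₁c₂ E(t,v)^{1/2} for every t ∈ [0,T]. Consequently, if η(x,t) = x + ∫₀ᵗ v(x,s) ds, then ‖D²η(t)‖_{L^∞(Ω)} ≤ C‖D²η(t)‖_{H²(Ω)} ≤ C t sup_{0≤s≤t} E(s,v)^{1/2}. -/

import Mathlib

open MeasureTheory Real Filter

noncomputable section

/-- The reference domain `Ω = 𝕋 × (0,1)`, realized as the fundamental square `(0,1) × (0,1)`. -/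
def Oset : Set (ℝ × ℝ) := Set.Ioo (0:ℝ) 1 ×ˢ Set.Ioo (0:ℝ) 1

/-- The vacuum boundary `Γ = 𝕋 × {0,1}`. -/
def Gset : Set (ℝ × ℝ) := {x : ℝ × ℝ | x.2 = 0 ∨ x.2 = 1}

/-- Distance to the boundary `Γ`. -/
def distG (x : ℝ × ℝ) : ℝ := min x.2 (1 - x.2)

variable {F : Type*} [NormedAddCommGroup F] [NormedSpace ℝ F]

/-- Horizontal partial derivative `∂₁`. -/
def pd1 (f : ℝ × ℝ → F) : ℝ × ℝ → F := fun x => fderiv ℝ f x (1, 0)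

/-- Vertical (normal) partial derivative `∂₂`. -/
def pd2 (f : ℝ × ℝ → F) : ℝ × ℝ → F := fun x => fderiv ℝ f x (0, 1)

/-- Time derivative `∂ₜ`. -/
def pdt (v : ℝ → ℝ × ℝ → F) : ℝ → ℝ × ℝ → F := fun t x => deriv (fun s => v s x) t

/-- `|Df|²` at a point. -/
def gradSq (f : ℝ × ℝ → F) (x : ℝ × ℝ) : ℝ := ‖pd1 f x‖ ^ 2 + ‖pd2 f x‖ ^ 2

/-- 1-periodicity in the horizontal variable (functions on the torus `𝕋 × (0,1)`). -/
def Per (f : ℝ × ℝ → F) : Prop := ∀ x : ℝ × ℝ, f (x.1 + 1, x.2) = f x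

/-- Smoothness. -/
def SmoothFn (f : ℝ × ℝ → F) : Prop := ∀ n : ℕ, ContDiff ℝ n f

/-- Joint smoothness of a time dependent family. -/
def SmoothT (v : ℝ → ℝ × ℝ → F) : Prop :=
  ∀ n : ℕ, ContDiff ℝ n (fun p : ℝ × (ℝ × ℝ) => v p.1 p.2)

def PerT (v : ℝ → ℝ × ℝ → F) : Prop := ∀ t : ℝ, Per (v t)

/-- Admissible initial depth profile: smooth, periodic, vanishing on `Γ` and
comparable to the distance to the boundary. -/
def IsDensity (C₁ C₂ : ℝ) (ρ₀ : ℝ × ℝ → ℝ) : Prop :=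
  SmoothFn ρ₀ ∧ Per ρ₀ ∧ (∀ x ∈ Gset, ρ₀ x = 0) ∧
    ∀ x ∈ Oset, C₁ * distG x ≤ ρ₀ x ∧ ρ₀ x ≤ C₂ * distG x

/-- The higher-order energy functional `E(t,v)`. -/
def energy (ρ₀ : ℝ × ℝ → ℝ) (v : ℝ → ℝ × ℝ → ℝ × ℝ) (t : ℝ) : ℝ :=
  (∑ l₀ ∈ Finset.range 5, ∫ x in Oset, ρ₀ x * ‖(pdt^[l₀] v) t x‖ ^ 2)
    + (∑ l₀ ∈ Finset.range 4, ∑ l₁ ∈ Finset.range (7 - 2 * l₀),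
        ∫ x in Oset, ρ₀ x *
          (gradSq (pd1^[l₁] ((pdt^[l₀] v) t)) x + gradSq (pd1^[l₁ + 1] ((pdt^[l₀] v) t)) x))
    + ∑ l₀ ∈ Finset.range 4, ∑ l₁ ∈ Finset.range (7 - 2 * l₀),
        ∑ l₂ ∈ Finset.Icc 2 (8 - 2 * l₀ - l₁),
          ∫ x in Oset, ρ₀ x ^ l₂ * ‖(pd1^[l₁] (pd2^[l₂] ((pdt^[l₀] v) t))) x‖ ^ 2

/-- The Lagrangian flow map `η(x,t) = x + ∫₀ᵗ v(x,s) ds`. -/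
def flowMap (v : ℝ → ℝ × ℝ → ℝ × ℝ) (t : ℝ) (x : ℝ × ℝ) : ℝ × ℝ :=
  x + ∫ s in (0:ℝ)..t, v s x

/-- The (squared-sum) Sobolev `H^k(Ω)` norm. -/
def sobolevNorm (k : ℕ) (f : ℝ × ℝ → F) : ℝ :=
  Real.sqrt (∑ θ ∈ Finset.range (k + 1), ∫ x in Oset, ‖iteratedFDeriv ℝ θ f x‖ ^ 2)

/-- `sup_{0 ≤ s ≤ t} E(s,v)^{1/2}`. -/
def supEn (ρ₀ : ℝ × ℝ → ℝ) (v : ℝ → ℝ × ℝ → ℝ × ℝ) (t : ℝ) : ℝ :=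
  ⨆ s : Set.Icc (0:ℝ) t, Real.sqrt (energy ρ₀ v ↑s)

/-- Weighted `L²(Ω)` norm `‖ρ₀^p ∂₁^{l₁} D^k f‖_{L²(Ω)}`. -/
def wL2 (ρ₀ : ℝ × ℝ → ℝ) (p k l₁ : ℕ) (f : ℝ × ℝ → F) : ℝ :=
  Real.sqrt (∫ x in Oset, (ρ₀ x ^ p * ‖iteratedFDeriv ℝ k (pd1^[l₁] f) x‖) ^ 2)

/-- Weighted `L^∞(Ω)` norm `‖ρ₀^p ∂₁^{l₁} D^k f‖_{L^∞(Ω)}`. -/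
def wSup (ρ₀ : ℝ × ℝ → ℝ) (p k l₁ : ℕ) (f : ℝ × ℝ → F) : ℝ :=
  ⨆ x : Oset, ρ₀ (x : ℝ × ℝ) ^ p * ‖iteratedFDeriv ℝ k (pd1^[l₁] f) (x : ℝ × ℝ)‖

def pick (i : Fin 2) (w : ℝ × ℝ) : ℝ := if i = 0 then w.1 else w.2

def evec (k : Fin 2) : ℝ × ℝ := if k = 0 then (1, 0) else (0, 1)

def pdk (k : Fin 2) (f : ℝ × ℝ → ℝ) : ℝ × ℝ → ℝ := fun x => fderiv ℝ f x (evec k)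

/-- The cofactor matrix `a` of `Dη`, `a = [[∂₂η², −∂₂η¹], [−∂₁η², ∂₁η¹]]`,
indexed so that `cof η x i k = a_i^k`. -/
def cof (η : ℝ × ℝ → ℝ × ℝ) (x : ℝ × ℝ) (i k : Fin 2) : ℝ :=
  if i = 0 then
    (if k = 0 then pd2 (fun y => (η y).2) x else -pd1 (fun y => (η y).2) x)
  else
    (if k = 0 then -pd2 (fun y => (η y).1) x else pd1 (fun y => (η y).1) x)

/-- The Jacobian determinant `J = det Dη`. -/
def jac (η : ℝ × ℝ → ℝ × ℝ) (x : ℝ × ℝ) : ℝ :=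
  pd1 (fun y => (η y).1) x * pd2 (fun y => (η y).2) x
    - pd2 (fun y => (η y).1) x * pd1 (fun y => (η y).2) x

/-- `b^{kj} = a_l^k a_l^j`. -/
def bmat (η : ℝ × ℝ → ℝ × ℝ) (x : ℝ × ℝ) (k j : Fin 2) : ℝ :=
  ∑ l : Fin 2, cof η x l k * cof η x l j

/-- `(v,η)` is a (classical) solution of the Lagrangian system
`ρ₀ ∂ₜ v^i + (ρ₀² J⁻² a_i^k),_k = (ρ₀ J⁻² b^{kj} v^i,_j),_k` in `Ω × (0,T]`. -/
def IsLagSol (ρ₀ : ℝ × ℝ → ℝ) (v : ℝ → ℝ × ℝ → ℝ × ℝ) (T : ℝ) : Prop :=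
  ∀ t : ℝ, 0 < t → t ≤ T → ∀ x ∈ Oset, ∀ i : Fin 2,
    ρ₀ x * pick i (pdt v t x)
        + ∑ k : Fin 2, pdk k
            (fun y => ρ₀ y ^ 2 * jac (flowMap v t) y ^ (-2 : ℤ) * cof (flowMap v t) y i k) x
      = ∑ k : Fin 2, pdk k
          (fun y => ρ₀ y * jac (flowMap v t) y ^ (-2 : ℤ) *
            ∑ j : Fin 2, bmat (flowMap v t) y k j * pdk j (fun z => pick i (v t z)) y) x

/-- The a priori assumption: `sup_{0≤t≤T} E(t,v) ≤ M₁`,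
`T ∈ (0, 1/(20c₁c₂√M₁ + 10c₁²c₂²M₁)] ∩ (0,1)`, where `c₁, c₂` are the constants of the
embedding inequalities, so that in particular `‖Dv‖_{L^∞} ≤ c₁c₂ E^{1/2}`. -/
def Apriori (ρ₀ : ℝ × ℝ → ℝ) (v : ℝ → ℝ × ℝ → ℝ × ℝ) (T M₁ c₁ c₂ : ℝ) : Prop :=
  0 < c₁ ∧ 0 < c₂ ∧ 0 ≤ M₁ ∧ 0 < T ∧ T ≤ 1 ∧
    T ≤ 1 / (20 * c₁ * c₂ * Real.sqrt M₁ + 10 * c₁ ^ 2 * c₂ ^ 2 * M₁) ∧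
    (∀ t ∈ Set.Icc (0:ℝ) T, energy ρ₀ v t ≤ M₁) ∧
    ∀ t ∈ Set.Icc (0:ℝ) T, ∀ x ∈ Oset,
      ‖fderiv ℝ (v t) x‖ ≤ c₁ * c₂ * Real.sqrt (energy ρ₀ v t)

/-- Smooth test functions compactly supported in `Ω`. -/
def CinfTest (φ : ℝ × ℝ → ℝ) : Prop :=
  (∀ n : ℕ, ContDiff ℝ n φ) ∧ HasCompactSupport φ ∧ tsupport φ ⊆ Oset

/-- `g` is the weak directional derivative of `u` in direction `e` on `Ω`. -/
def WeakPD (e : ℝ × ℝ) (u g : ℝ × ℝ → ℝ) : Prop :=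
  ∀ φ : ℝ × ℝ → ℝ, CinfTest φ →
    ∫ x in Oset, u x * fderiv ℝ φ x e = -∫ x in Oset, g x * φ x

/-- Membership in the weighted space `H¹_{ρ₀}(Ω)`, with weak gradient `Dw`. -/
def InH1w (ρ₀ : ℝ × ℝ → ℝ) (w : ℝ × ℝ → ℝ) (Dw : ℝ × ℝ → ℝ × ℝ) : Prop :=
  AEStronglyMeasurable w (volume.restrict Oset) ∧
    AEStronglyMeasurable Dw (volume.restrict Oset) ∧
    IntegrableOn (fun x => ρ₀ x * (w x) ^ 2) Oset ∧
    IntegrableOn (fun x => ρ₀ x * ‖Dw x‖ ^ 2) Oset ∧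
    WeakPD (1, 0) w (fun x => (Dw x).1) ∧ WeakPD (0, 1) w (fun x => (Dw x).2)

/-- The bilinear form `B[w,φ]_μ = ∫_Ω ρ₀ (Dw·Dφ + wφ) dx`. -/
def Bform (ρ₀ : ℝ × ℝ → ℝ) (w : ℝ × ℝ → ℝ) (Dw : ℝ × ℝ → ℝ × ℝ)
    (φ : ℝ × ℝ → ℝ) (Dφ : ℝ × ℝ → ℝ × ℝ) : ℝ :=
  ∫ x in Oset, ρ₀ x * ((Dw x).1 * (Dφ x).1 + (Dw x).2 * (Dφ x).2 + w x * φ x)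

open scoped ContDiff

lemma aux_intO {g : ℝ × ℝ → ℝ} (h : Continuous g) : IntegrableOn g Oset := by
  have h1 : IntegrableOn g (Set.Icc (0:ℝ) 1 ×ˢ Set.Icc (0:ℝ) 1) :=
    h.continuousOn.integrableOn_compact (isCompact_Icc.prod isCompact_Icc)
  exact h1.mono_set (Set.prod_mono Set.Ioo_subset_Icc_self Set.Ioo_subset_Icc_self)

lemma aux_measO : MeasurableSet Oset := measurableSet_Ioo.prod measurableSet_Ioo

lemma aux_fubini {g : ℝ × ℝ → ℝ} (h : Continuous g) :
    ∫ x in Oset, g x = ∫ x in (0:ℝ)..1, ∫ y in (0:ℝ)..1, g (x, y) := by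
  have h1 := setIntegral_prod (μ := (volume : Measure ℝ)) (ν := (volume : Measure ℝ)) g
    (s := Set.Ioo (0:ℝ) 1) (t := Set.Ioo (0:ℝ) 1) (aux_intO h)
  simp only [intervalIntegral.integral_of_le (zero_le_one (α := ℝ)), integral_Ioc_eq_integral_Ioo]
  exact h1

lemma aux_fubini' {g : ℝ × ℝ → ℝ} (h : Continuous g) :
    ∫ x in Oset, g x = ∫ y in (0:ℝ)..1, ∫ x in (0:ℝ)..1, g (x, y) := by
  rw [aux_fubini h]
  simp only [intervalIntegral.integral_of_le (zero_le_one (α := ℝ))]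
  refine integral_integral_swap ?_
  rw [Measure.prod_restrict]
  have h1 : IntegrableOn g (Set.Icc (0:ℝ) 1 ×ˢ Set.Icc (0:ℝ) 1) :=
    h.continuousOn.integrableOn_compact (isCompact_Icc.prod isCompact_Icc)
  exact h1.mono_set (Set.prod_mono Set.Ioc_subset_Icc_self Set.Ioc_subset_Icc_self)

lemma aux_mono {f g : ℝ × ℝ → ℝ} (hf : Continuous f) (hg : Continuous g)
    (h : ∀ x ∈ Oset, f x ≤ g x) : ∫ x in Oset, f x ≤ ∫ x in Oset, g x :=
  setIntegral_mono_on (aux_intO hf) (aux_intO hg) aux_measO h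

/-- Cauchy-Schwarz on `[0,t]`. -/
lemma aux_cs {g : ℝ → ℝ} (hg : Continuous g) {t : ℝ} (ht : 0 ≤ t) :
    (∫ s in (0:ℝ)..t, g s) ^ 2 ≤ t * ∫ s in (0:ℝ)..t, g s ^ 2 := by
  rcases ht.eq_or_lt with rfl | ht'
  · simp
  set m := ∫ s in (0:ℝ)..t, g s with hm
  have h0 : 0 ≤ ∫ s in (0:ℝ)..t, (t * g s - m) ^ 2 :=
    intervalIntegral.integral_nonneg ht (fun s _ => sq_nonneg _)
  have h1 : ∫ s in (0:ℝ)..t, (t * g s - m) ^ 2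
      = t ^ 2 * (∫ s in (0:ℝ)..t, g s ^ 2) - 2 * t * m * m + m ^ 2 * t := by
    have : ∀ s, (t * g s - m) ^ 2 = (t ^ 2 * g s ^ 2 - 2 * t * m * g s) + m ^ 2 := by
      intro s; ring
    simp only [this]
    have c1 : Continuous fun s => t ^ 2 * g s ^ 2 := by fun_prop
    have c2 : Continuous fun s => 2 * t * m * g s := by fun_prop
    have c3 : Continuous fun s => t ^ 2 * g s ^ 2 - 2 * t * m * g s := by fun_prop
    rw [intervalIntegral.integral_add (c3.intervalIntegrable _ _)
      (continuous_const.intervalIntegrable _ _),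
      intervalIntegral.integral_sub (c1.intervalIntegrable _ _) (c2.intervalIntegrable _ _),
      intervalIntegral.integral_const_mul, intervalIntegral.integral_const_mul, ← hm]
    simp; ring
  rw [h1] at h0
  have h2 : 0 ≤ t * (t * (∫ s in (0:ℝ)..t, g s ^ 2) - m ^ 2) := by linarith
  have := nonneg_of_mul_nonneg_right h2 ht'
  linarith

/-- One-dimensional Hardy inequality. -/
lemma aux_hardy1 {f f' : ℝ → ℝ} (hf : ∀ y, HasDerivAt f (f' y) y) (hf' : Continuous f') (n : ℕ) :
    ∫ y in (0:ℝ)..1, (y * (1 - y)) ^ n * f y ^ 2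
      ≤ 72 * ∫ y in (0:ℝ)..1, (y * (1 - y)) ^ (n + 2) * (f y ^ 2 + f' y ^ 2) := by
  have cf : Continuous f := continuous_iff_continuousAt.2 fun y => (hf y).continuousAt
  set q : ℝ → ℝ := fun y => y * (1 - y) with hq
  have hqd : ∀ y, HasDerivAt q (1 - 2 * y) y := by
    intro y
    have := (hasDerivAt_id y).mul ((hasDerivAt_id y).const_sub 1)
    refine this.congr_deriv ?_
    simp; ring
  let G : ℝ → ℝ := fun y => q y ^ (n + 1) * (1 - 2 * y) * f y ^ 2
  let G' : ℝ → ℝ := fun y => (n + 1) * q y ^ n * (1 - 2 * y) ^ 2 * f y ^ 2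
    - 2 * q y ^ (n + 1) * f y ^ 2 + 2 * q y ^ (n + 1) * (1 - 2 * y) * f y * f' y
  have hG : ∀ y, HasDerivAt G (G' y) y := by
    intro y
    have h1 := (hqd y).pow (n + 1)
    have h2 : HasDerivAt (fun y : ℝ => 1 - 2 * y) (-2) y := by
      have := ((hasDerivAt_id y).const_mul 2).const_sub 1
      simpa using this
    have h3 := (hf y).pow 2
    refine ((h1.mul h2).mul h3).congr_deriv ?_
    simp [G']; ring
  have cq : Continuous q := by fun_prop
  have cG' : Continuous G' := by fun_prop
  have hI : ∫ y in (0:ℝ)..1, G' y = 0 := by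
    rw [intervalIntegral.integral_eq_sub_of_hasDerivAt (fun y _ => hG y)
      (cG'.intervalIntegrable _ _)]
    simp [G, hq]
  have hpt : ∀ y ∈ Set.Icc (0:ℝ) 1, (n + 1 : ℝ) / 2 * (q y ^ n * f y ^ 2)
      ≤ G' y + 36 * (n + 1) * (q y ^ (n + 2) * (f y ^ 2 + f' y ^ 2)) := by
    intro y hy
    have hq0 : 0 ≤ q y := mul_nonneg hy.1 (by linarith [hy.2])
    have hqe : (1 - 2 * y) ^ 2 = 1 - 4 * q y := by simp [hq]; ring
    have e : G' y + 36 * (n + 1) * (q y ^ (n + 2) * (f y ^ 2 + f' y ^ 2))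
        - (n + 1 : ℝ) / 2 * (q y ^ n * f y ^ 2)
        = q y ^ n * ((n + 1) * (1 - 2 * y) ^ 2 * f y ^ 2 - 2 * q y * f y ^ 2
          + 2 * q y * (1 - 2 * y) * f y * f' y
          + 36 * (n + 1) * (q y ^ 2 * (f y ^ 2 + f' y ^ 2)) - (n + 1) / 2 * f y ^ 2) := by
      simp only [G']; ring
    have hN : (0:ℝ) ≤ n := Nat.cast_nonneg n
    have key : 0 ≤ (n + 1) * (1 - 2 * y) ^ 2 * f y ^ 2 - 2 * q y * f y ^ 2
          + 2 * q y * (1 - 2 * y) * f y * f' y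
          + 36 * (n + 1) * (q y ^ 2 * (f y ^ 2 + f' y ^ 2)) - (n + 1) / 2 * f y ^ 2 := by
      rw [hqe]
      generalize q y = Q at *
      generalize f y = a at *
      generalize f' y = b at *
      have s1 : (1 - 2 * y) ^ 2 ≤ 1 := by rw [hqe]; linarith
      have k1 : 0 ≤ (n:ℝ) * a ^ 2 * (1 / 2 - 6 * Q) ^ 2 := by positivity
      have k1' : 0 ≤ a ^ 2 * (1 / 2 - 6 * Q) ^ 2 := by positivity
      have k2 : 0 ≤ (a / 2 + 2 * Q * (1 - 2 * y) * b) ^ 2 := sq_nonneg _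
      have k3 : (1 - 2 * y) ^ 2 * (Q ^ 2 * b ^ 2) ≤ 1 * (Q ^ 2 * b ^ 2) :=
        mul_le_mul_of_nonneg_right s1 (by positivity)
      have k4 : 0 ≤ (n:ℝ) * (Q ^ 2 * b ^ 2) := by positivity
      have k5 : 0 ≤ Q ^ 2 * b ^ 2 := by positivity
      have k6 : 0 ≤ (n:ℝ) * (Q * a ^ 2) := by positivity
      have k7 : 0 ≤ (n:ℝ) * (a ^ 2) := by positivity
      nlinarith
    have := mul_nonneg (pow_nonneg hq0 n) key
    rw [← e] at this
    linarith
  have c1 : Continuous fun y => q y ^ n * f y ^ 2 := by fun_prop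
  have c2 : Continuous fun y => q y ^ (n + 2) * (f y ^ 2 + f' y ^ 2) := by fun_prop
  have c3 : Continuous fun y => G' y + 36 * (n + 1) * (q y ^ (n + 2) * (f y ^ 2 + f' y ^ 2)) := by
    fun_prop
  have hintg := intervalIntegral.integral_mono_on (μ := volume) zero_le_one
    ((c1.const_mul ((n + 1 : ℝ) / 2)).intervalIntegrable 0 1)
    (c3.intervalIntegrable 0 1) hpt
  rw [intervalIntegral.integral_add (cG'.intervalIntegrable _ _)
    ((c2.const_mul (36 * (n + 1 : ℝ))).intervalIntegrable 0 1), hI,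
    intervalIntegral.integral_const_mul, intervalIntegral.integral_const_mul] at hintg
  have hN : (0:ℝ) < (n + 1) / 2 := by positivity
  refine le_of_mul_le_mul_left ?_ hN
  linarith

/-- One-dimensional Sobolev inequality. -/
lemma aux_sob1 [CompleteSpace F] {f f' : ℝ → F} (hf : ∀ y, HasDerivAt f (f' y) y)
    (hf' : Continuous f') {a : ℝ} (ha : a ∈ Set.Icc (0:ℝ) 1) :
    ‖f a‖ ^ 2 ≤ 2 * ∫ y in (0:ℝ)..1, (‖f y‖ ^ 2 + ‖f' y‖ ^ 2) := by
  have cf : Continuous f := continuous_iff_continuousAt.2 fun y => (hf y).continuousAt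
  have hb : ∀ b ∈ Set.Icc (0:ℝ) 1, ‖f a‖ ^ 2 ≤ 2 * ‖f b‖ ^ 2 + 2 * ∫ y in (0:ℝ)..1, ‖f' y‖ ^ 2 := by
    intro b hb
    have h1 : ∫ y in b..a, f' y = f a - f b :=
      intervalIntegral.integral_eq_sub_of_hasDerivAt (fun y _ => hf y) (hf'.intervalIntegrable _ _)
    have h2 : ‖f a - f b‖ ≤ ∫ y in (0:ℝ)..1, ‖f' y‖ := by
      rw [← h1]
      refine intervalIntegral.norm_integral_le_integral_norm_uIoc.trans ?_
      rw [intervalIntegral.integral_of_le zero_le_one]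
      refine setIntegral_mono_set ?_ ?_ ?_
      · exact (intervalIntegrable_iff_integrableOn_Ioc_of_le zero_le_one).1
          (hf'.norm.intervalIntegrable 0 1)
      · exact Eventually.of_forall fun _ => norm_nonneg _
      · refine LE.le.eventuallyLE ?_
        refine Set.Ioc_subset_Ioc (le_min hb.1 ha.1) (max_le hb.2 ha.2)
    have h3 := aux_cs hf'.norm (zero_le_one (α := ℝ))
    have h4 : ‖f a‖ ≤ ‖f b‖ + ‖f a - f b‖ := by
      have := norm_add_le (f b) (f a - f b)
      simpa using this
    have h5 : ‖f a - f b‖ ^ 2 ≤ (∫ y in (0:ℝ)..1, ‖f' y‖) ^ 2 :=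
      pow_le_pow_left₀ (norm_nonneg _) h2 2
    have h6 : ‖f a‖ ^ 2 ≤ (‖f b‖ + ‖f a - f b‖) ^ 2 := pow_le_pow_left₀ (norm_nonneg _) h4 2
    nlinarith [sq_nonneg (‖f b‖ - ‖f a - f b‖)]
  have c1 : Continuous fun b => ‖f b‖ ^ 2 := by fun_prop
  have c2 : Continuous fun b => ‖f' b‖ ^ 2 := by fun_prop
  have c3 : Continuous fun b => 2 * ‖f b‖ ^ 2 + 2 * ∫ y in (0:ℝ)..1, ‖f' y‖ ^ 2 := by fun_prop
  have hintg := intervalIntegral.integral_mono_on (μ := volume) (zero_le_one (α := ℝ))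
    (continuous_const.intervalIntegrable 0 1)
    (c3.intervalIntegrable 0 1) hb
  rw [intervalIntegral.integral_add ((c1.const_mul 2).intervalIntegrable _ _)
    (continuous_const.intervalIntegrable 0 1), intervalIntegral.integral_const_mul] at hintg
  rw [intervalIntegral.integral_add (c1.intervalIntegrable _ _) (c2.intervalIntegrable _ _)]
  simp at hintg
  linarith


lemma aux_pd1_smooth {f : ℝ × ℝ → F} (h : ContDiff ℝ ∞ f) : ContDiff ℝ ∞ (pd1 f) :=
  (h.fderiv_right (m := ∞) (by simp)).clm_apply contDiff_const

lemma aux_pd2_smooth {f : ℝ × ℝ → F} (h : ContDiff ℝ ∞ f) : ContDiff ℝ ∞ (pd2 f) :=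
  (h.fderiv_right (m := ∞) (by simp)).clm_apply contDiff_const

lemma aux_pd1_it {f : ℝ × ℝ → F} (h : ContDiff ℝ ∞ f) (a : ℕ) : ContDiff ℝ ∞ (pd1^[a] f) := by
  induction a with
  | zero => exact h
  | succ k ih => rw [Function.iterate_succ_apply']; exact aux_pd1_smooth ih

lemma aux_pd2_it {f : ℝ × ℝ → F} (h : ContDiff ℝ ∞ f) (a : ℕ) : ContDiff ℝ ∞ (pd2^[a] f) := by
  induction a with
  | zero => exact h
  | succ k ih => rw [Function.iterate_succ_apply']; exact aux_pd2_smooth ih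

lemma aux_comm {f : ℝ × ℝ → F} (h : ContDiff ℝ ∞ f) : pd2 (pd1 f) = pd1 (pd2 f) := by
  ext x
  have hd : DifferentiableAt ℝ (fderiv ℝ f) x :=
    (h.fderiv_right (m := ∞) (by simp)).differentiable (by simp) x
  have e : ∀ u w : ℝ × ℝ, fderiv ℝ (fun y => fderiv ℝ f y u) x w = fderiv ℝ (fderiv ℝ f) x w u := by
    intro u w
    rw [fderiv_clm_apply hd (differentiableAt_const _)]
    simp
  have hs : IsSymmSndFDerivAt ℝ f x :=
    h.contDiffAt.isSymmSndFDerivAt (by simp; exact WithTop.coe_le_coe.2 le_top)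
  show fderiv ℝ (fun y => fderiv ℝ f y (1, 0)) x (0, 1)
    = fderiv ℝ (fun y => fderiv ℝ f y (0, 1)) x (1, 0)
  rw [e, e]
  exact hs _ _

lemma aux_comm1 {f : ℝ × ℝ → F} (h : ContDiff ℝ ∞ f) (b : ℕ) :
    pd2^[b] (pd1 f) = pd1 (pd2^[b] f) := by
  induction b with
  | zero => rfl
  | succ k ih =>
    rw [Function.iterate_succ_apply', ih, aux_comm (aux_pd2_it h k), Function.iterate_succ_apply']

lemma aux_comm2 {f : ℝ × ℝ → F} (h : ContDiff ℝ ∞ f) (a b : ℕ) :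
    pd2^[b] (pd1^[a] f) = pd1^[a] (pd2^[b] f) := by
  induction a with
  | zero => rfl
  | succ k ih =>
    rw [Function.iterate_succ_apply', aux_comm1 (aux_pd1_it h k), ih, Function.iterate_succ_apply']

lemma aux_hd2 {f : ℝ × ℝ → F} (h : ContDiff ℝ ∞ f) (x y : ℝ) :
    HasDerivAt (fun y => f (x, y)) (pd2 f (x, y)) y := by
  have h1 : HasFDerivAt f (fderiv ℝ f (x, y)) (x, y) :=
    (h.differentiable (by simp) (x, y)).hasFDerivAt
  have h2 : HasDerivAt (fun y : ℝ => (x, y)) ((0:ℝ), (1:ℝ)) y :=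
    (hasDerivAt_const y x).prodMk (hasDerivAt_id y)
  exact h1.comp_hasDerivAt y h2

lemma aux_hd1 {f : ℝ × ℝ → F} (h : ContDiff ℝ ∞ f) (x y : ℝ) :
    HasDerivAt (fun x => f (x, y)) (pd1 f (x, y)) x := by
  have h1 : HasFDerivAt f (fderiv ℝ f (x, y)) (x, y) :=
    (h.differentiable (by simp) (x, y)).hasFDerivAt
  have h2 : HasDerivAt (fun x : ℝ => (x, y)) ((1:ℝ), (0:ℝ)) x :=
    (hasDerivAt_id x).prodMk (hasDerivAt_const x y)
  exact h1.comp_hasDerivAt x h2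

/-- The weighted integral used in the Hardy inequality. -/
def auxI (n : ℕ) (g : ℝ × ℝ → F) : ℝ := ∫ x in Oset, (x.2 * (1 - x.2)) ^ n * ‖g x‖ ^ 2

/-- Hardy inequality in the slab, scalar case. -/
lemma aux_hardy2s {g : ℝ × ℝ → ℝ} (h : ContDiff ℝ ∞ g) (n : ℕ) :
    ∫ x in Oset, (x.2 * (1 - x.2)) ^ n * g x ^ 2
      ≤ 72 * ∫ x in Oset, (x.2 * (1 - x.2)) ^ (n + 2) * (g x ^ 2 + pd2 g x ^ 2) := by
  have cg : Continuous g := h.continuous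
  have cg' : Continuous (pd2 g) := (aux_pd2_smooth h).continuous
  rw [aux_fubini (by fun_prop), aux_fubini (by fun_prop), ← intervalIntegral.integral_const_mul]
  refine intervalIntegral.integral_mono_on zero_le_one ?_ ?_ ?_
  · refine Continuous.intervalIntegrable ?_ _ _
    refine intervalIntegral.continuous_parametric_intervalIntegral_of_continuous' ?_ _ _
    fun_prop
  · refine Continuous.intervalIntegrable ?_ _ _
    refine Continuous.mul continuous_const ?_
    refine intervalIntegral.continuous_parametric_intervalIntegral_of_continuous' ?_ _ _
    fun_prop
  · intro x _
    exact aux_hardy1 (fun y => aux_hd2 h x y) (by fun_prop) n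

lemma aux_pd2_fst {g : ℝ × ℝ → ℝ × ℝ} (h : ContDiff ℝ ∞ g) (x : ℝ × ℝ) :
    pd2 (fun y => (g y).1) x = (pd2 g x).1 := by
  have h1 : HasFDerivAt g (fderiv ℝ g x) x := (h.differentiable (by simp) x).hasFDerivAt
  have := h1.fst.fderiv
  simp only [pd2]
  rw [this]; rfl

lemma aux_pd2_snd {g : ℝ × ℝ → ℝ × ℝ} (h : ContDiff ℝ ∞ g) (x : ℝ × ℝ) :
    pd2 (fun y => (g y).2) x = (pd2 g x).2 := by
  have h1 : HasFDerivAt g (fderiv ℝ g x) x := (h.differentiable (by simp) x).hasFDerivAt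
  have := h1.snd.fderiv
  simp only [pd2]
  rw [this]; rfl

lemma aux_q_nonneg {x : ℝ × ℝ} (hx : x ∈ Oset) : 0 ≤ x.2 * (1 - x.2) :=
  mul_nonneg hx.2.1.le (by linarith [hx.2.2])

lemma aux_norm_sq_le (w : ℝ × ℝ) : ‖w‖ ^ 2 ≤ w.1 ^ 2 + w.2 ^ 2 := by
  rw [Prod.norm_def]
  rcases max_choice ‖w.1‖ ‖w.2‖ with h | h <;> rw [h] <;> simp [sq_abs] <;> positivity

lemma aux_sq_le_norm (w : ℝ × ℝ) : w.1 ^ 2 + w.2 ^ 2 ≤ 2 * ‖w‖ ^ 2 := by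
  have h1 : w.1 ^ 2 ≤ ‖w‖ ^ 2 := by
    rw [← sq_abs]; exact pow_le_pow_left₀ (abs_nonneg _) (norm_fst_le w) 2
  have h2 : w.2 ^ 2 ≤ ‖w‖ ^ 2 := by
    rw [← sq_abs]; exact pow_le_pow_left₀ (abs_nonneg _) (norm_snd_le w) 2
  linarith

lemma aux_hardy2 {g : ℝ × ℝ → ℝ × ℝ} (h : ContDiff ℝ ∞ g) (n : ℕ) :
    auxI n g ≤ 144 * (auxI (n + 2) g + auxI (n + 2) (pd2 g)) := by
  have cg : Continuous g := h.continuous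
  have cg' : Continuous (pd2 g) := (aux_pd2_smooth h).continuous
  have h1 := aux_hardy2s h.fst n
  have h2 := aux_hardy2s h.snd n
  simp only [aux_pd2_fst h, aux_pd2_snd h] at h1 h2
  have e1 : auxI n g ≤ (∫ x in Oset, (x.2 * (1 - x.2)) ^ n * (g x).1 ^ 2)
      + ∫ x in Oset, (x.2 * (1 - x.2)) ^ n * (g x).2 ^ 2 := by
    rw [← integral_add (aux_intO (by fun_prop)) (aux_intO (by fun_prop))]
    refine aux_mono (by fun_prop) (by fun_prop) fun x hx => ?_
    rw [← mul_add]
    exact mul_le_mul_of_nonneg_left (aux_norm_sq_le _) (pow_nonneg (aux_q_nonneg hx) _)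
  have e2 : (∫ x in Oset, (x.2 * (1 - x.2)) ^ (n + 2) * ((g x).1 ^ 2 + (pd2 g x).1 ^ 2))
      + (∫ x in Oset, (x.2 * (1 - x.2)) ^ (n + 2) * ((g x).2 ^ 2 + (pd2 g x).2 ^ 2))
      ≤ 2 * (auxI (n + 2) g + auxI (n + 2) (pd2 g)) := by
    rw [auxI, auxI, ← integral_add (aux_intO (by fun_prop)) (aux_intO (by fun_prop)),
      ← integral_add (aux_intO (by fun_prop)) (aux_intO (by fun_prop)), ← integral_const_mul]
    refine aux_mono (by fun_prop) (by fun_prop) fun x hx => ?_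
    have k := mul_le_mul_of_nonneg_left
      (add_le_add (aux_sq_le_norm (g x)) (aux_sq_le_norm (pd2 g x)))
      (pow_nonneg (aux_q_nonneg hx) (n + 2))
    linarith
  linarith

lemma aux_hardy_it (k : ℕ) : ∀ (g : ℝ × ℝ → ℝ × ℝ), ContDiff ℝ ∞ g → ∀ (n : ℕ) (M : ℝ),
    (∀ j ≤ k, auxI (n + 2 * k) (pd2^[j] g) ≤ M) → auxI n g ≤ 288 ^ k * M := by
  induction k with
  | zero => intro g _ n M hM; simpa using hM 0 le_rfl
  | succ k ih =>
    intro g hg n M hM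
    have h0 := aux_hardy2 hg n
    have h1 := ih g hg (n + 2) M (fun j hj => by
      have := hM j (by omega)
      rwa [show n + 2 * (k + 1) = n + 2 + 2 * k by ring] at this)
    have h2 := ih (pd2 g) (aux_pd2_smooth hg) (n + 2) M (fun j hj => by
      have := hM (j + 1) (by omega)
      rwa [show n + 2 * (k + 1) = n + 2 + 2 * k by ring, Function.iterate_succ_apply] at this)
    rw [pow_succ]
    linarith

/-- Sobolev embedding on the square. -/
lemma aux_sob2 [CompleteSpace F] {w : ℝ × ℝ → F} (h : ContDiff ℝ ∞ w) {x : ℝ × ℝ} (hx : x ∈ Oset) :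
    ‖w x‖ ^ 2 ≤ 4 * ∫ y in Oset, (‖w y‖ ^ 2 + ‖pd1 w y‖ ^ 2 + (‖pd2 w y‖ ^ 2
      + ‖pd1 (pd2 w) y‖ ^ 2)) := by
  have h1 := aux_pd1_smooth h
  have h2 := aux_pd2_smooth h
  have h12 := aux_pd1_smooth h2
  have c0 := h.continuous
  have c1 := h1.continuous
  have c2 := h2.continuous
  have c12 := h12.continuous
  rw [aux_fubini' (by fun_prop)]
  obtain ⟨x1, x2⟩ := x
  have hx1 : x1 ∈ Set.Icc (0:ℝ) 1 := ⟨hx.1.1.le, hx.1.2.le⟩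
  have hx2 : x2 ∈ Set.Icc (0:ℝ) 1 := ⟨hx.2.1.le, hx.2.2.le⟩
  have s1 := aux_sob1 (fun y => aux_hd2 h x1 y) (by fun_prop) hx2
  have s2 : ∀ y : ℝ, ‖w (x1, y)‖ ^ 2 + ‖pd2 w (x1, y)‖ ^ 2 ≤
      2 * ∫ x in (0:ℝ)..1, (‖w (x, y)‖ ^ 2 + ‖pd1 w (x, y)‖ ^ 2 + (‖pd2 w (x, y)‖ ^ 2
      + ‖pd1 (pd2 w) (x, y)‖ ^ 2)) := by
    intro y
    have t1 := aux_sob1 (fun x => aux_hd1 h x y) (by fun_prop) hx1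
    have t2 := aux_sob1 (fun x => aux_hd1 h2 x y) (by fun_prop) hx1
    rw [intervalIntegral.integral_add]
    · linarith
    · exact Continuous.intervalIntegrable (by fun_prop) _ _
    · exact Continuous.intervalIntegrable (by fun_prop) _ _
  have s3 : ∫ y in (0:ℝ)..1, (‖w (x1, y)‖ ^ 2 + ‖pd2 w (x1, y)‖ ^ 2) ≤
      ∫ y in (0:ℝ)..1, 2 * ∫ x in (0:ℝ)..1, (‖w (x, y)‖ ^ 2 + ‖pd1 w (x, y)‖ ^ 2
        + (‖pd2 w (x, y)‖ ^ 2 + ‖pd1 (pd2 w) (x, y)‖ ^ 2)) := by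
    refine intervalIntegral.integral_mono_on zero_le_one ?_ ?_ fun y _ => s2 y
    · exact Continuous.intervalIntegrable (by fun_prop) _ _
    · refine Continuous.intervalIntegrable (Continuous.mul continuous_const ?_) _ _
      refine intervalIntegral.continuous_parametric_intervalIntegral_of_continuous' ?_ _ _
      fun_prop
  rw [intervalIntegral.integral_const_mul] at s3
  linarith

lemma aux_pd1_le (f : ℝ × ℝ → F) (x : ℝ × ℝ) : ‖pd1 f x‖ ≤ ‖fderiv ℝ f x‖ := by
  have := (fderiv ℝ f x).le_opNorm (1, 0)
  simpa [Prod.norm_def, pd1, pd2] using this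

lemma aux_pd2_le (f : ℝ × ℝ → F) (x : ℝ × ℝ) : ‖pd2 f x‖ ≤ ‖fderiv ℝ f x‖ := by
  have := (fderiv ℝ f x).le_opNorm (0, 1)
  simpa [Prod.norm_def, pd1, pd2] using this

lemma aux_itF_smooth {f : ℝ × ℝ → F} (h : ContDiff ℝ ∞ f) (n : ℕ) :
    ContDiff ℝ ∞ (iteratedFDeriv ℝ n f) :=
  h.iteratedFDeriv_right (m := ∞) (by exact WithTop.coe_le_coe.2 le_top)

lemma aux_fderiv_comp_le {E₁ E₂ : Type*} [NormedAddCommGroup E₁] [NormedSpace ℝ E₁]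
    [NormedAddCommGroup E₂] [NormedSpace ℝ E₂] (L : E₁ →L[ℝ] E₂) (hL : ∀ u, ‖L u‖ ≤ ‖u‖)
    {g : ℝ × ℝ → E₁} {y : ℝ × ℝ} (hg : DifferentiableAt ℝ g y) :
    ‖fderiv ℝ (fun z => L (g z)) y‖ ≤ ‖fderiv ℝ g y‖ := by
  have e : fderiv ℝ (fun z => L (g z)) y = L.comp (fderiv ℝ g y) :=
    (L.hasFDerivAt.comp y hg.hasFDerivAt).fderiv
  rw [e]
  refine ContinuousLinearMap.opNorm_le_bound _ (norm_nonneg _) fun u => ?_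
  exact (hL _).trans ((fderiv ℝ g y).le_opNorm u)

lemma aux_curry_le (n : ℕ) (u : ContinuousMultilinearMap ℝ (fun _ : Fin (n + 1) => ℝ × ℝ) F) :
    ‖u.curryLeft ((0:ℝ), (1:ℝ))‖ ≤ ‖u‖ := by
  have k2 := u.curryLeft.le_opNorm ((0:ℝ), (1:ℝ))
  have k3 : ‖((0:ℝ), (1:ℝ))‖ = 1 := by simp [Prod.norm_def]
  rwa [k3, mul_one, ContinuousMultilinearMap.curryLeft_norm] at k2

lemma aux_curryL (n : ℕ) :
    ∃ L : (ContinuousMultilinearMap ℝ (fun _ : Fin (n + 1) => ℝ × ℝ) F) →L[ℝ]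
      (ContinuousMultilinearMap ℝ (fun _ : Fin n => ℝ × ℝ) F),
      (∀ u, ‖L u‖ ≤ ‖u‖) ∧ ∀ u, L u = u.curryLeft ((0:ℝ), (1:ℝ)) := by
  refine ⟨LinearMap.mkContinuous
    { toFun := fun u => u.curryLeft ((0:ℝ), (1:ℝ))
      map_add' := fun u w => by ext; simp
      map_smul' := fun c u => by ext; simp } 1 ?_, ?_, ?_⟩
  · intro u
    rw [one_mul]
    exact aux_curry_le n u
  · intro u
    exact aux_curry_le n u
  · intro u
    rfl

lemma aux_curry_it (f : ℝ × ℝ → F) (n : ℕ) (z : ℝ × ℝ) :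
    (iteratedFDeriv ℝ (n + 1) f z).curryLeft = fderiv ℝ (iteratedFDeriv ℝ n f) z := by
  rw [iteratedFDeriv_succ_eq_comp_left]
  exact ContinuousLinearMap.curry_uncurryLeft _

lemma aux_sob_main [CompleteSpace F] {f : ℝ × ℝ → F} (h : ContDiff ℝ ∞ f) {x : ℝ × ℝ}
    (hx : x ∈ Oset) :
    ‖iteratedFDeriv ℝ 2 f x‖ ≤ 3 * Real.sqrt (∑ θ ∈ Finset.Icc 2 4,
                  ∫ y in Oset, ‖iteratedFDeriv ℝ θ f y‖ ^ 2) := by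
  have hw := aux_itF_smooth h 2
  have s := aux_sob2 hw hx
  have c2 := (aux_itF_smooth h 2).continuous
  have c3 := (aux_itF_smooth h 3).continuous
  have c4 := (aux_itF_smooth h 4).continuous
  have d1 := (aux_pd1_smooth hw).continuous
  have d2 := (aux_pd2_smooth hw).continuous
  have d12 := (aux_pd1_smooth (aux_pd2_smooth hw)).continuous
  have b1 : ∀ y, ‖pd1 (iteratedFDeriv ℝ 2 f) y‖ ≤ ‖iteratedFDeriv ℝ 3 f y‖ := fun y =>
    (aux_pd1_le _ y).trans_eq norm_fderiv_iteratedFDeriv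
  have b2 : ∀ y, ‖pd2 (iteratedFDeriv ℝ 2 f) y‖ ≤ ‖iteratedFDeriv ℝ 3 f y‖ := fun y =>
    (aux_pd2_le _ y).trans_eq norm_fderiv_iteratedFDeriv
  have b12 : ∀ y, ‖pd1 (pd2 (iteratedFDeriv ℝ 2 f)) y‖ ≤ ‖iteratedFDeriv ℝ 4 f y‖ := by
    intro y
    refine (aux_pd1_le _ y).trans ?_
    have hd : DifferentiableAt ℝ (iteratedFDeriv ℝ 3 f) y :=
      (aux_itF_smooth h 3).differentiable (by simp) y
    obtain ⟨L, hL, hLe⟩ := aux_curryL (F := F) 2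
    have e : pd2 (iteratedFDeriv ℝ 2 f) = fun z => L (iteratedFDeriv ℝ 3 f z) := by
      ext1 z
      rw [hLe, aux_curry_it]
      rfl
    rw [e]
    refine (aux_fderiv_comp_le L hL hd).trans_eq norm_fderiv_iteratedFDeriv
  have hsum : ∑ θ ∈ Finset.Icc 2 4, ∫ y in Oset, ‖iteratedFDeriv ℝ θ f y‖ ^ 2
      = (∫ y in Oset, ‖iteratedFDeriv ℝ 2 f y‖ ^ 2) + (∫ y in Oset, ‖iteratedFDeriv ℝ 3 f y‖ ^ 2)
        + ∫ y in Oset, ‖iteratedFDeriv ℝ 4 f y‖ ^ 2 := by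
    rw [show Finset.Icc 2 4 = {2, 3, 4} by decide]
    simp [add_assoc]
  rw [hsum]
  have k : ∫ y in Oset, (‖iteratedFDeriv ℝ 2 f y‖ ^ 2 + ‖pd1 (iteratedFDeriv ℝ 2 f) y‖ ^ 2
      + (‖pd2 (iteratedFDeriv ℝ 2 f) y‖ ^ 2 + ‖pd1 (pd2 (iteratedFDeriv ℝ 2 f)) y‖ ^ 2))
      ≤ ∫ y in Oset, 2 * (‖iteratedFDeriv ℝ 2 f y‖ ^ 2 + ‖iteratedFDeriv ℝ 3 f y‖ ^ 2
        + ‖iteratedFDeriv ℝ 4 f y‖ ^ 2) := by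
    refine aux_mono (by fun_prop) (by fun_prop) fun y _ => ?_
    have := pow_le_pow_left₀ (norm_nonneg _) (b1 y) 2
    have := pow_le_pow_left₀ (norm_nonneg _) (b2 y) 2
    have := pow_le_pow_left₀ (norm_nonneg _) (b12 y) 2
    nlinarith [sq_nonneg ‖iteratedFDeriv ℝ 2 f y‖, sq_nonneg ‖iteratedFDeriv ℝ 4 f y‖]
  have k' : ∫ y in Oset, (‖iteratedFDeriv ℝ 2 f y‖ ^ 2 + ‖iteratedFDeriv ℝ 3 f y‖ ^ 2
        + ‖iteratedFDeriv ℝ 4 f y‖ ^ 2) = (∫ y in Oset, ‖iteratedFDeriv ℝ 2 f y‖ ^ 2)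
        + (∫ y in Oset, ‖iteratedFDeriv ℝ 3 f y‖ ^ 2)
        + ∫ y in Oset, ‖iteratedFDeriv ℝ 4 f y‖ ^ 2 := by
    rw [integral_add (aux_intO (by fun_prop)) (aux_intO (by fun_prop)),
      integral_add (aux_intO (by fun_prop)) (aux_intO (by fun_prop))]
  rw [integral_const_mul, k'] at k
  set S := (∫ y in Oset, ‖iteratedFDeriv ℝ 2 f y‖ ^ 2) + (∫ y in Oset, ‖iteratedFDeriv ℝ 3 f y‖ ^ 2)
        + ∫ y in Oset, ‖iteratedFDeriv ℝ 4 f y‖ ^ 2 with hS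
  have hS0 : 0 ≤ S := by
    rw [hS]; positivity
  refine abs_le_of_sq_le_sq' ?_ (by positivity) |>.2
  rw [mul_pow, Real.sq_sqrt hS0]
  linarith


lemma aux_fderiv_decomp (f : ℝ × ℝ → F) : fderiv ℝ f = fun x =>
    ContinuousLinearMap.smulRightL ℝ (ℝ × ℝ) F (ContinuousLinearMap.fst ℝ ℝ ℝ) (pd1 f x)
    + ContinuousLinearMap.smulRightL ℝ (ℝ × ℝ) F (ContinuousLinearMap.snd ℝ ℝ ℝ) (pd2 f x) := by
  ext1 x
  ext <;> simp [pd1, pd2]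

lemma aux_smulRightL_norm (c : ℝ × ℝ →L[ℝ] ℝ) (hc : ‖c‖ ≤ 1) :
    ‖ContinuousLinearMap.smulRightL ℝ (ℝ × ℝ) F c‖ ≤ 1 := by
  refine ContinuousLinearMap.opNorm_le_bound _ zero_le_one fun u => ?_
  rw [ContinuousLinearMap.smulRightL_apply_apply, ContinuousLinearMap.norm_smulRight_apply]
  exact mul_le_mul_of_nonneg_right hc (norm_nonneg _)

lemma aux_Dn_step {f : ℝ × ℝ → F} (h : ContDiff ℝ ∞ f) (n : ℕ) (x : ℝ × ℝ) :
    ‖iteratedFDeriv ℝ (n + 1) f x‖ ≤ ‖iteratedFDeriv ℝ n (pd1 f) x‖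
      + ‖iteratedFDeriv ℝ n (pd2 f) x‖ := by
  rw [← norm_iteratedFDeriv_fderiv, aux_fderiv_decomp f]
  set A := ContinuousLinearMap.smulRightL ℝ (ℝ × ℝ) F (ContinuousLinearMap.fst ℝ ℝ ℝ)
  set B := ContinuousLinearMap.smulRightL ℝ (ℝ × ℝ) F (ContinuousLinearMap.snd ℝ ℝ ℝ)
  have hA : ‖A‖ ≤ 1 := aux_smulRightL_norm _ (ContinuousLinearMap.norm_fst_le ..)
  have hB : ‖B‖ ≤ 1 := aux_smulRightL_norm _ (ContinuousLinearMap.norm_snd_le ..)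
  have h1 : ContDiff ℝ n (pd1 f) := (aux_pd1_smooth h).of_le (mod_cast le_top)
  have h2 : ContDiff ℝ n (pd2 f) := (aux_pd2_smooth h).of_le (mod_cast le_top)
  have e1 := A.norm_iteratedFDeriv_comp_left (h1.contDiffAt (x := x)) (le_refl (n : WithTop ℕ∞))
  have e2 := B.norm_iteratedFDeriv_comp_left (h2.contDiffAt (x := x)) (le_refl (n : WithTop ℕ∞))
  have e3 : iteratedFDeriv ℝ n (fun x => A (pd1 f x) + B (pd2 f x)) x
      = iteratedFDeriv ℝ n (A ∘ pd1 f) x + iteratedFDeriv ℝ n (B ∘ pd2 f) x :=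
    iteratedFDeriv_add_apply (A.contDiff.comp h1).contDiffAt (B.contDiff.comp h2).contDiffAt
  rw [e3]
  refine (norm_add_le _ _).trans (add_le_add (e1.trans ?_) (e2.trans ?_))
  · exact mul_le_of_le_one_left (norm_nonneg _) hA
  · exact mul_le_of_le_one_left (norm_nonneg _) hB

lemma aux_Dn (n : ℕ) : ∀ (f : ℝ × ℝ → F), ContDiff ℝ ∞ f → ∀ (x : ℝ × ℝ) (B : ℝ),
    (∀ a b, a + b = n → ‖pd1^[a] (pd2^[b] f) x‖ ≤ B) → ‖iteratedFDeriv ℝ n f x‖ ≤ 2 ^ n * B := by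
  induction n with
  | zero => intro f _ x B hB; simpa using hB 0 0 rfl
  | succ n ih =>
    intro f hf x B hB
    have h1 := ih (pd1 f) (aux_pd1_smooth hf) x B (fun a b hab => by
      have := hB (a + 1) b (by omega)
      rwa [Function.iterate_succ_apply, ← aux_comm1 hf] at this)
    have h2 := ih (pd2 f) (aux_pd2_smooth hf) x B (fun a b hab => by
      have := hB a (b + 1) (by omega)
      rwa [Function.iterate_succ_apply] at this)
    have := aux_Dn_step hf n x
    rw [pow_succ]
    linarith

lemma aux_Dn_sq {f : ℝ × ℝ → F} (hf : ContDiff ℝ ∞ f) (n : ℕ) (x : ℝ × ℝ) :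
    ‖iteratedFDeriv ℝ n f x‖ ^ 2 ≤ 4 ^ n * ∑ p ∈ Finset.HasAntidiagonal.antidiagonal n,
      ‖pd1^[p.1] (pd2^[p.2] f) x‖ ^ 2 := by
  have hS : 0 ≤ ∑ p ∈ Finset.HasAntidiagonal.antidiagonal n, ‖pd1^[p.1] (pd2^[p.2] f) x‖ ^ 2 :=
    Finset.sum_nonneg fun p _ => sq_nonneg _
  have h := aux_Dn n f hf x (Real.sqrt (∑ p ∈ Finset.HasAntidiagonal.antidiagonal n,
      ‖pd1^[p.1] (pd2^[p.2] f) x‖ ^ 2)) (fun a b hab => by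
    refine Real.le_sqrt_of_sq_le ?_
    exact Finset.single_le_sum (f := fun p : ℕ × ℕ => ‖pd1^[p.1] (pd2^[p.2] f) x‖ ^ 2)
      (fun p _ => sq_nonneg _) (Finset.HasAntidiagonal.mem_antidiagonal.2 hab : (a, b) ∈ _))
  have h2 := pow_le_pow_left₀ (norm_nonneg _) h 2
  rw [mul_pow, Real.sq_sqrt hS, ← pow_mul, mul_comm n 2, pow_mul] at h2
  norm_num at h2
  exact h2

lemma aux_parcont {g : ℝ → ℝ × ℝ → ℝ} (h : Continuous fun p : ℝ × (ℝ × ℝ) => g p.1 p.2) :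
    Continuous fun t => ∫ x in Oset, g t x := by
  have e : (fun t => ∫ x in Oset, g t x)
      = fun t => ∫ x in (0:ℝ)..1, ∫ y in (0:ℝ)..1, g t (x, y) := by
    ext t
    have : Continuous fun x => g t x :=
      h.comp (continuous_const.prodMk continuous_id)
    exact aux_fubini this
  rw [e]
  refine intervalIntegral.continuous_parametric_intervalIntegral_of_continuous' ?_ _ _
  refine intervalIntegral.continuous_parametric_intervalIntegral_of_continuous'
    (f := fun (p : ℝ × ℝ) y => g p.1 (p.2, y)) ?_ _ _
  exact h.comp (by fun_prop : Continuous fun q : (ℝ × ℝ) × ℝ => (q.1.1, (q.1.2, q.2)))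

/-- Joint smoothness. -/
def AuxST (v : ℝ → ℝ × ℝ → F) : Prop := ContDiff ℝ ∞ (fun p : ℝ × (ℝ × ℝ) => v p.1 p.2)

lemma aux_ST_sec {v : ℝ → ℝ × ℝ → F} (h : AuxST v) (t : ℝ) : ContDiff ℝ ∞ (v t) :=
  h.comp (contDiff_const.prodMk contDiff_id)

lemma aux_ST_hasF {v : ℝ → ℝ × ℝ → F} (h : AuxST v) (t : ℝ) (x : ℝ × ℝ) :
    HasFDerivAt (v t) ((fderiv ℝ (fun p : ℝ × (ℝ × ℝ) => v p.1 p.2) (t, x)).comp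
      (ContinuousLinearMap.inr ℝ ℝ (ℝ × ℝ))) x := by
  have h1 : HasFDerivAt (fun p : ℝ × (ℝ × ℝ) => v p.1 p.2) _ (t, x) :=
    (ContDiff.differentiable h (by simp) (t, x)).hasFDerivAt
  exact h1.comp x (hasFDerivAt_prodMk_right t x)

lemma aux_ST_fd {v : ℝ → ℝ × ℝ → F} (h : AuxST v) : AuxST (fun t => fderiv ℝ (v t)) := by
  have e : (fun p : ℝ × (ℝ × ℝ) => fderiv ℝ (v p.1) p.2)
    = fun p => (fderiv ℝ (fun p : ℝ × (ℝ × ℝ) => v p.1 p.2) p).comp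
      (ContinuousLinearMap.inr ℝ ℝ (ℝ × ℝ)) := by
    ext1 p
    exact (aux_ST_hasF h p.1 p.2).fderiv
  show ContDiff ℝ ∞ (fun p : ℝ × (ℝ × ℝ) => fderiv ℝ (v p.1) p.2)
  rw [e]
  exact (ContDiff.fderiv_right (m := ∞) h (by simp)).clm_comp contDiff_const

lemma aux_ST_pd1 {v : ℝ → ℝ × ℝ → F} (h : AuxST v) : AuxST (fun t => pd1 (v t)) :=
  ContDiff.clm_apply (aux_ST_fd h) contDiff_const

lemma aux_ST_pd2 {v : ℝ → ℝ × ℝ → F} (h : AuxST v) : AuxST (fun t => pd2 (v t)) :=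
  ContDiff.clm_apply (aux_ST_fd h) contDiff_const

lemma aux_ST_pd1_it {v : ℝ → ℝ × ℝ → F} (h : AuxST v) (a : ℕ) :
    AuxST (fun t => pd1^[a] (v t)) := by
  induction a with
  | zero => exact h
  | succ k ih => simp only [Function.iterate_succ_apply']; exact aux_ST_pd1 ih

lemma aux_ST_pd2_it {v : ℝ → ℝ × ℝ → F} (h : AuxST v) (a : ℕ) :
    AuxST (fun t => pd2^[a] (v t)) := by
  induction a with
  | zero => exact h
  | succ k ih => simp only [Function.iterate_succ_apply']; exact aux_ST_pd2 ih

lemma aux_ST_pdt {v : ℝ → ℝ × ℝ → F} (h : AuxST v) : AuxST (pdt v) := by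
  have e : (fun p : ℝ × (ℝ × ℝ) => pdt v p.1 p.2)
    = fun p => fderiv ℝ (fun p : ℝ × (ℝ × ℝ) => v p.1 p.2) p (1, 0) := by
    ext1 p
    have h1 : HasFDerivAt (fun p : ℝ × (ℝ × ℝ) => v p.1 p.2) _ (p.1, p.2) :=
      (ContDiff.differentiable h (by simp) (p.1, p.2)).hasFDerivAt
    have h2 : HasDerivAt (fun s : ℝ => (s, p.2)) ((1:ℝ), (0: ℝ × ℝ)) p.1 :=
      (hasDerivAt_id _).prodMk (hasDerivAt_const _ _)
    exact (h1.comp_hasDerivAt p.1 h2).deriv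
  show ContDiff ℝ ∞ (fun p : ℝ × (ℝ × ℝ) => pdt v p.1 p.2)
  rw [e]
  exact (ContDiff.fderiv_right (m := ∞) h (by simp)).clm_apply contDiff_const

lemma aux_ST_pdt_it {v : ℝ → ℝ × ℝ → F} (h : AuxST v) (a : ℕ) : AuxST (pdt^[a] v) := by
  induction a with
  | zero => exact h
  | succ k ih => rw [Function.iterate_succ_apply']; exact aux_ST_pdt ih

lemma aux_energy_cont {ρ₀ : ℝ × ℝ → ℝ} (hρ : Continuous ρ₀) {v : ℝ → ℝ × ℝ → ℝ × ℝ}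
    (h : AuxST v) : Continuous (energy ρ₀ v) := by
  have hρ' : Continuous fun p : ℝ × (ℝ × ℝ) => ρ₀ p.2 := hρ.comp continuous_snd
  unfold energy
  refine Continuous.add (Continuous.add ?_ ?_) ?_
  · refine continuous_finsetSum _ fun l₀ _ => aux_parcont ?_
    have := ContDiff.continuous (aux_ST_pdt_it h l₀)
    fun_prop
  · refine continuous_finsetSum _ fun l₀ _ => continuous_finsetSum _ fun l₁ _ => aux_parcont ?_
    have h0 := aux_ST_pdt_it h l₀
    have c1 := ContDiff.continuous (aux_ST_pd1 (aux_ST_pd1_it h0 l₁))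
    have c2 := ContDiff.continuous (aux_ST_pd2 (aux_ST_pd1_it h0 l₁))
    have c3 := ContDiff.continuous (aux_ST_pd1 (aux_ST_pd1_it h0 (l₁ + 1)))
    have c4 := ContDiff.continuous (aux_ST_pd2 (aux_ST_pd1_it h0 (l₁ + 1)))
    unfold gradSq
    exact hρ'.mul (((c1.norm.pow 2).add (c2.norm.pow 2)).add ((c3.norm.pow 2).add (c4.norm.pow 2)))
  · refine continuous_finsetSum _ fun l₀ _ => continuous_finsetSum _ fun l₁ _ =>
      continuous_finsetSum _ fun l₂ _ => aux_parcont ?_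
    have c1 := ContDiff.continuous (aux_ST_pd1_it (aux_ST_pd2_it (aux_ST_pdt_it h l₀) l₂) l₁)
    exact (hρ'.pow _).mul (c1.norm.pow 2)

lemma aux_int_hasF {G : ℝ → ℝ × ℝ → F} (h : AuxST G) (t : ℝ) (x : ℝ × ℝ) :
    HasFDerivAt (fun x => ∫ s in (0:ℝ)..t, G s x) (∫ s in (0:ℝ)..t, fderiv ℝ (G s) x) x := by
  have cG : Continuous fun p : ℝ × (ℝ × ℝ) => G p.1 p.2 := ContDiff.continuous h
  have cG' : Continuous fun p : ℝ × (ℝ × ℝ) => fderiv ℝ (G p.1) p.2 :=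
    ContDiff.continuous (aux_ST_fd h)
  have cs : ∀ x, Continuous fun s => G s x := fun x =>
    cG.comp (continuous_id.prodMk continuous_const)
  have cs' : ∀ x, Continuous fun s => fderiv ℝ (G s) x := fun x =>
    cG'.comp (continuous_id.prodMk continuous_const)
  obtain ⟨K, hK⟩ := (isCompact_uIcc.prod (isCompact_closedBall x 1)).exists_bound_of_continuousOn
    (s := Set.uIcc (0:ℝ) t ×ˢ Metric.closedBall x 1) cG'.continuousOn
  refine intervalIntegral.hasFDerivAt_integral_of_dominated_of_fderiv_le
    (F := fun x s => G s x) (F' := fun x s => fderiv ℝ (G s) x) (bound := fun _ => K)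
    (Metric.closedBall_mem_nhds x one_pos) ?_ ?_ ?_ ?_ ?_ ?_
  · exact Eventually.of_forall fun y => (cs y).aestronglyMeasurable
  · exact (cs x).intervalIntegrable _ _
  · exact (cs' x).aestronglyMeasurable
  · exact Eventually.of_forall fun s hs y hy => hK (s, y) ⟨Set.uIoc_subset_uIcc hs, hy⟩
  · exact continuous_const.intervalIntegrable _ _
  · exact Eventually.of_forall fun s _ y _ =>
      ((aux_ST_sec h s).differentiable (by simp) y).hasFDerivAt

lemma aux_int_fd {G : ℝ → ℝ × ℝ → F} (h : AuxST G) (t : ℝ) :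
    fderiv ℝ (fun x => ∫ s in (0:ℝ)..t, G s x) = fun x => ∫ s in (0:ℝ)..t, fderiv ℝ (G s) x :=
  funext fun x => (aux_int_hasF h t x).fderiv

universe u

lemma aux_int_smooth (n : ℕ) : ∀ {E : Type u} [NormedAddCommGroup E] [NormedSpace ℝ E]
    {G : ℝ → ℝ × ℝ → E} (_ : AuxST G) (t : ℝ),
    ContDiff ℝ n (fun x => ∫ s in (0:ℝ)..t, G s x) := by
  induction n with
  | zero =>
    intro E _ _ G h t
    exact contDiff_zero.2 (continuous_iff_continuousAt.2 fun x => (aux_int_hasF h t x).continuousAt)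
  | succ n ih =>
    intro E _ _ G h t
    push_cast
    rw [contDiff_succ_iff_fderiv]
    refine ⟨fun x => (aux_int_hasF h t x).differentiableAt, by simp, ?_⟩
    rw [aux_int_fd h]
    exact ih (aux_ST_fd h) t

lemma aux_int_norm (n : ℕ) : ∀ {E : Type u} [NormedAddCommGroup E] [NormedSpace ℝ E]
    {G : ℝ → ℝ × ℝ → E} (_ : AuxST G) (t : ℝ) (_ : 0 ≤ t) (x : ℝ × ℝ),
    ‖iteratedFDeriv ℝ n (fun x => ∫ s in (0:ℝ)..t, G s x) x‖
      ≤ ∫ s in (0:ℝ)..t, ‖iteratedFDeriv ℝ n (G s) x‖ := by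
  induction n with
  | zero =>
    intro E _ _ G h t ht x
    simpa using intervalIntegral.norm_integral_le_integral_norm ht
  | succ n ih =>
    intro E _ _ G h t ht x
    simp only [← norm_iteratedFDeriv_fderiv]
    rw [aux_int_fd h]
    exact ih (aux_ST_fd h) t ht x

lemma aux_norm_cont (n : ℕ) : ∀ {E : Type u} [NormedAddCommGroup E] [NormedSpace ℝ E]
    {G : ℝ → ℝ × ℝ → E} (_ : AuxST G),
    Continuous fun p : ℝ × (ℝ × ℝ) => ‖iteratedFDeriv ℝ n (G p.1) p.2‖ := by
  induction n with
  | zero =>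
    intro E _ _ G h
    simpa using (ContDiff.continuous h).norm
  | succ n ih =>
    intro E _ _ G h
    simp only [← norm_iteratedFDeriv_fderiv]
    exact ih (aux_ST_fd h)

lemma aux_flow_smooth {v : ℝ → ℝ × ℝ → ℝ × ℝ} (h : AuxST v) (t : ℝ) :
    ContDiff ℝ ∞ (flowMap v t) := by
  rw [contDiff_infty]
  intro n
  exact contDiff_id.add (aux_int_smooth n h t)

lemma aux_flow_norm {v : ℝ → ℝ × ℝ → ℝ × ℝ} (h : AuxST v) {t : ℝ} (ht : 0 ≤ t) (n : ℕ)
    (x : ℝ × ℝ) : ‖iteratedFDeriv ℝ (n + 2) (flowMap v t) x‖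
      ≤ ∫ s in (0:ℝ)..t, ‖iteratedFDeriv ℝ (n + 2) (v s) x‖ := by
  have e1 : fderiv ℝ (flowMap v t) = fun x => ContinuousLinearMap.id ℝ (ℝ × ℝ)
      + ∫ s in (0:ℝ)..t, fderiv ℝ (v s) x :=
    funext fun x => ((hasFDerivAt_id x).add (aux_int_hasF h t x)).fderiv
  have e2 : fderiv ℝ (fderiv ℝ (flowMap v t)) = fun x =>
      ∫ s in (0:ℝ)..t, fderiv ℝ (fderiv ℝ (v s)) x := by
    rw [e1]
    funext x
    exact ((aux_int_hasF (aux_ST_fd h) t x).const_add _).fderiv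
  simp only [← norm_iteratedFDeriv_fderiv]
  rw [e2]
  exact aux_int_norm n (aux_ST_fd (aux_ST_fd h)) t ht x

lemma aux_swap {g : ℝ → ℝ × ℝ → ℝ} (h : Continuous fun p : ℝ × (ℝ × ℝ) => g p.1 p.2) {t : ℝ}
    (ht : 0 ≤ t) :
    ∫ x in Oset, ∫ s in (0:ℝ)..t, g s x = ∫ s in (0:ℝ)..t, ∫ x in Oset, g s x := by
  simp only [intervalIntegral.integral_of_le ht]
  refine (integral_integral_swap ?_).symm
  rw [Measure.prod_restrict]
  have h1 : IntegrableOn (Function.uncurry g)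
      (Set.Icc (0:ℝ) t ×ˢ (Set.Icc (0:ℝ) 1 ×ˢ Set.Icc (0:ℝ) 1)) :=
    h.continuousOn.integrableOn_compact
      (isCompact_Icc.prod (isCompact_Icc.prod isCompact_Icc))
  exact h1.mono_set (Set.prod_mono Set.Ioc_subset_Icc_self
    (Set.prod_mono Set.Ioo_subset_Icc_self Set.Ioo_subset_Icc_self))

lemma aux_flow_int_gen {N : ℝ → ℝ × ℝ → ℝ} {M : ℝ × ℝ → ℝ} (cM : Continuous M)
    (c : Continuous fun p : ℝ × (ℝ × ℝ) => N p.1 p.2) {t : ℝ} (ht : 0 ≤ t) (hM : ∀ x, 0 ≤ M x)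
    (hMN : ∀ x, M x ≤ ∫ s in (0:ℝ)..t, N s x) :
    ∫ x in Oset, M x ^ 2 ≤ t * ∫ s in (0:ℝ)..t, ∫ x in Oset, N s x ^ 2 := by
  have c2 : Continuous fun p : ℝ × (ℝ × ℝ) => N p.1 p.2 ^ 2 := c.pow 2
  rw [← aux_swap (g := fun s x => N s x ^ 2) c2 ht, ← integral_const_mul]
  refine aux_mono (by fun_prop) ?_ fun x _ => ?_
  · refine Continuous.mul continuous_const ?_
    refine intervalIntegral.continuous_parametric_intervalIntegral_of_continuous' ?_ _ _
    exact c2.comp (continuous_snd.prodMk continuous_fst)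
  · have cs : Continuous fun s => N s x := c.comp (continuous_id.prodMk continuous_const)
    exact (pow_le_pow_left₀ (hM x) (hMN x) 2).trans (aux_cs cs ht)

lemma aux_flow_int {v : ℝ → ℝ × ℝ → ℝ × ℝ} (h : AuxST v) {t : ℝ} (ht : 0 ≤ t) (n : ℕ) :
    ∫ x in Oset, ‖iteratedFDeriv ℝ (n + 2) (flowMap v t) x‖ ^ 2
      ≤ t * ∫ s in (0:ℝ)..t, ∫ x in Oset, ‖iteratedFDeriv ℝ (n + 2) (v s) x‖ ^ 2 :=
  aux_flow_int_gen (N := fun s x => ‖iteratedFDeriv ℝ (n + 2) (v s) x‖)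
    (M := fun x => ‖iteratedFDeriv ℝ (n + 2) (flowMap v t) x‖)
    (aux_itF_smooth (aux_flow_smooth h t) (n + 2)).continuous.norm
    (aux_norm_cont (n + 2) h) ht (fun _ => norm_nonneg _) (aux_flow_norm h ht n)


lemma aux_rho_nonneg {C₁ C₂ : ℝ} (hC₁ : 0 < C₁) {ρ₀ : ℝ × ℝ → ℝ} (hρ : IsDensity C₁ C₂ ρ₀)
    {x : ℝ × ℝ} (hx : x ∈ Oset) : 0 ≤ ρ₀ x := by
  refine le_trans ?_ (hρ.2.2.2 x hx).1
  exact mul_nonneg hC₁.le (le_min hx.2.1.le (by linarith [hx.2.2]))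

lemma aux_weight {C₁ C₂ : ℝ} (hC₁ : 0 < C₁) {ρ₀ : ℝ × ℝ → ℝ} (hρ : IsDensity C₁ C₂ ρ₀)
    {x : ℝ × ℝ} (hx : x ∈ Oset) {l m : ℕ} (hlm : l ≤ m) (hl : l ≤ 8) :
    (x.2 * (1 - x.2)) ^ m ≤ (max 1 (1 / C₁)) ^ 8 * ρ₀ x ^ l := by
  have h0 := aux_q_nonneg hx
  have hx1 := hx.2.1
  have hx2 := hx.2.2
  have h1 : x.2 * (1 - x.2) ≤ 1 := by nlinarith
  have hK : 1 ≤ max 1 (1 / C₁) := le_max_left _ _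
  have hK' : 1 / C₁ ≤ max 1 (1 / C₁) := le_max_right _ _
  have hr := aux_rho_nonneg hC₁ hρ hx
  have hd : x.2 * (1 - x.2) ≤ distG x := by
    refine le_min ?_ ?_ <;> nlinarith
  have h2 : x.2 * (1 - x.2) ≤ max 1 (1 / C₁) * ρ₀ x := by
    have h3 := (hρ.2.2.2 x hx).1
    have h4 : distG x ≤ 1 / C₁ * ρ₀ x := by
      rw [one_div, ← div_eq_inv_mul, le_div_iff₀ hC₁]; linarith
    exact (hd.trans h4).trans (mul_le_mul_of_nonneg_right hK' hr)
  calc (x.2 * (1 - x.2)) ^ m ≤ (x.2 * (1 - x.2)) ^ l := pow_le_pow_of_le_one h0 h1 hlm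
    _ ≤ (max 1 (1 / C₁) * ρ₀ x) ^ l := pow_le_pow_left₀ h0 h2 l
    _ = (max 1 (1 / C₁)) ^ l * ρ₀ x ^ l := mul_pow _ _ _
    _ ≤ _ := mul_le_mul_of_nonneg_right (pow_le_pow_right₀ hK hl) (pow_nonneg hr l)

lemma aux_auxI_le {C₁ C₂ : ℝ} (hC₁ : 0 < C₁) {ρ₀ : ℝ × ℝ → ℝ} (hρ : IsDensity C₁ C₂ ρ₀)
    {g : ℝ × ℝ → ℝ × ℝ} {H : ℝ × ℝ → ℝ} (cg : Continuous g) (cH : Continuous H)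
    (hH : ∀ x, ‖g x‖ ^ 2 ≤ H x) {l m : ℕ} (hlm : l ≤ m) (hl : l ≤ 8) {E : ℝ}
    (hE : ∫ x in Oset, ρ₀ x ^ l * H x ≤ E) :
    auxI m g ≤ (max 1 (1 / C₁)) ^ 8 * E := by
  have cρ : Continuous ρ₀ := (hρ.1 0).continuous
  have hK : (0:ℝ) ≤ max 1 (1 / C₁) := zero_le_one.trans (le_max_left _ _)
  refine le_trans ?_ (mul_le_mul_of_nonneg_left hE (pow_nonneg hK 8))
  rw [auxI, ← integral_const_mul]
  refine aux_mono (by fun_prop) (by fun_prop) fun x hx => ?_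
  rw [← mul_assoc]
  have hr := aux_rho_nonneg hC₁ hρ hx
  exact mul_le_mul (aux_weight hC₁ hρ hx hlm hl) (hH x) (sq_nonneg _) (by positivity)

lemma aux_energy_terms {C₁ C₂ : ℝ} (hC₁ : 0 < C₁) {ρ₀ : ℝ × ℝ → ℝ} (hρ : IsDensity C₁ C₂ ρ₀)
    (v : ℝ → ℝ × ℝ → ℝ × ℝ) (t : ℝ) :
    0 ≤ energy ρ₀ v t ∧
    (∫ x in Oset, ρ₀ x * ‖v t x‖ ^ 2 ≤ energy ρ₀ v t) ∧
    (∀ l₁ < 7, ∫ x in Oset, ρ₀ x *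
      (gradSq (pd1^[l₁] (v t)) x + gradSq (pd1^[l₁ + 1] (v t)) x) ≤ energy ρ₀ v t) ∧
    (∀ l₁ < 7, ∀ l₂, 2 ≤ l₂ → l₂ + l₁ ≤ 8 →
      ∫ x in Oset, ρ₀ x ^ l₂ * ‖(pd1^[l₁] (pd2^[l₂] (v t))) x‖ ^ 2 ≤ energy ρ₀ v t) := by
  have n1 : ∀ l₀, 0 ≤ ∫ x in Oset, ρ₀ x * ‖(pdt^[l₀] v) t x‖ ^ 2 := fun l₀ =>
    setIntegral_nonneg aux_measO fun x hx =>
      mul_nonneg (aux_rho_nonneg hC₁ hρ hx) (sq_nonneg _)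
  have n2 : ∀ l₀ l₁, 0 ≤ ∫ x in Oset, ρ₀ x *
      (gradSq (pd1^[l₁] ((pdt^[l₀] v) t)) x + gradSq (pd1^[l₁ + 1] ((pdt^[l₀] v) t)) x) :=
    fun l₀ l₁ => setIntegral_nonneg aux_measO fun x hx =>
      mul_nonneg (aux_rho_nonneg hC₁ hρ hx) (by unfold gradSq; positivity)
  have n3 : ∀ l₀ l₁ l₂, 0 ≤
      ∫ x in Oset, ρ₀ x ^ l₂ * ‖(pd1^[l₁] (pd2^[l₂] ((pdt^[l₀] v) t))) x‖ ^ 2 :=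
    fun l₀ l₁ l₂ => setIntegral_nonneg aux_measO fun x hx =>
      mul_nonneg (pow_nonneg (aux_rho_nonneg hC₁ hρ hx) _) (sq_nonneg _)
  have s1 := Finset.sum_nonneg (s := Finset.range 5) fun l₀ _ => n1 l₀
  have s2 := Finset.sum_nonneg (s := Finset.range 4) fun l₀ _ =>
    Finset.sum_nonneg (s := Finset.range (7 - 2 * l₀)) fun l₁ _ => n2 l₀ l₁
  have s3 := Finset.sum_nonneg (s := Finset.range 4) fun l₀ _ =>
    Finset.sum_nonneg (s := Finset.range (7 - 2 * l₀)) fun l₁ _ =>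
      Finset.sum_nonneg (s := Finset.Icc 2 (8 - 2 * l₀ - l₁)) fun l₂ _ => n3 l₀ l₁ l₂
  refine ⟨?_, ?_, ?_, ?_⟩
  · unfold energy; linarith
  · have k := Finset.single_le_sum (s := Finset.range 5) (fun l₀ _ => n1 l₀)
      (Finset.mem_range.2 (by norm_num : 0 < 5))
    simp only [Function.iterate_zero, id_eq] at k
    unfold energy; linarith
  · intro l₁ hl₁
    have k := Finset.single_le_sum (s := Finset.range 4) (fun l₀ _ =>
      Finset.sum_nonneg (s := Finset.range (7 - 2 * l₀)) fun l₁ _ => n2 l₀ l₁)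
      (Finset.mem_range.2 (by norm_num : 0 < 4))
    have k2 := Finset.single_le_sum (s := Finset.range (7 - 2 * 0)) (fun l₁ _ => n2 0 l₁)
      (Finset.mem_range.2 (by omega : l₁ < 7 - 2 * 0))
    simp only [Function.iterate_zero, id_eq] at k k2
    unfold energy; linarith
  · intro l₁ hl₁ l₂ h2 h8
    have k := Finset.single_le_sum (s := Finset.range 4) (fun l₀ _ =>
      Finset.sum_nonneg (s := Finset.range (7 - 2 * l₀)) fun l₁ _ =>
      Finset.sum_nonneg (s := Finset.Icc 2 (8 - 2 * l₀ - l₁)) fun l₂ _ => n3 l₀ l₁ l₂)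
      (Finset.mem_range.2 (by norm_num : 0 < 4))
    have k2 := Finset.single_le_sum (s := Finset.range (7 - 2 * 0)) (fun l₁ _ =>
      Finset.sum_nonneg (s := Finset.Icc 2 (8 - 2 * 0 - l₁)) fun l₂ _ => n3 0 l₁ l₂)
      (Finset.mem_range.2 (by omega : l₁ < 7 - 2 * 0))
    have k3 := Finset.single_le_sum (s := Finset.Icc 2 (8 - 2 * 0 - l₁)) (fun l₂ _ => n3 0 l₁ l₂)
      (Finset.mem_Icc.2 (⟨h2, by omega⟩ : 2 ≤ l₂ ∧ l₂ ≤ 8 - 2 * 0 - l₁))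
    simp only [Function.iterate_zero, id_eq] at k k2 k3
    unfold energy; linarith

lemma aux_key {C₁ C₂ : ℝ} (hC₁ : 0 < C₁) {ρ₀ : ℝ × ℝ → ℝ} (hρ : IsDensity C₁ C₂ ρ₀)
    {v : ℝ → ℝ × ℝ → ℝ × ℝ} (hv : AuxST v) (t : ℝ) {a b : ℕ} (hab : a + b ≤ 4) :
    ∫ x in Oset, ‖pd1^[a] (pd2^[b] (v t)) x‖ ^ 2
      ≤ 288 ^ 4 * ((max 1 (1 / C₁)) ^ 8 * energy ρ₀ v t) := by
  obtain ⟨E0, E1, E2, E3⟩ := aux_energy_terms hC₁ hρ v t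
  have hf : ContDiff ℝ ∞ (v t) := aux_ST_sec hv t
  set f := v t with hfdef
  set E := energy ρ₀ v t with hEdef
  set K := (max 1 (1 / C₁)) ^ 8 with hKdef
  have hK : 0 ≤ K := by positivity
  have cgrad : ∀ a, Continuous (fun x => gradSq (pd1^[a] f) x + gradSq (pd1^[a + 1] f) x) := by
    intro a
    have c1 := (aux_pd1_smooth (aux_pd1_it hf a)).continuous
    have c2 := (aux_pd2_smooth (aux_pd1_it hf a)).continuous
    have c3 := (aux_pd1_smooth (aux_pd1_it hf (a + 1))).continuous
    have c4 := (aux_pd2_smooth (aux_pd1_it hf (a + 1))).continuous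
    unfold gradSq
    fun_prop
  have T0 : auxI 2 f ≤ K * E :=
    aux_auxI_le hC₁ hρ hf.continuous (H := fun x => ‖f x‖ ^ 2) (hf.continuous.norm.pow 2)
      (fun _ => le_rfl) (l := 1) (by norm_num) (by norm_num) (by simpa using E1)
  have T1 : ∀ a < 7, auxI 2 (pd1 (pd1^[a] f)) ≤ K * E := fun a ha =>
    aux_auxI_le hC₁ hρ (aux_pd1_smooth (aux_pd1_it hf a)).continuous (cgrad a)
      (fun x => by
        have h1 := sq_nonneg (‖pd1 (pd1^[a] f) x‖)
        have h2 := sq_nonneg (‖pd2 (pd1^[a] f) x‖)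
        have h3 := sq_nonneg (‖pd1 (pd1^[a + 1] f) x‖)
        have h4 := sq_nonneg (‖pd2 (pd1^[a + 1] f) x‖)
        unfold gradSq
        linarith)
      (l := 1) (by norm_num) (by norm_num) (by simpa using E2 a ha)
  have T2 : ∀ a < 7, auxI 2 (pd2 (pd1^[a] f)) ≤ K * E := fun a ha =>
    aux_auxI_le hC₁ hρ (aux_pd2_smooth (aux_pd1_it hf a)).continuous (cgrad a)
      (fun x => by
        have h1 := sq_nonneg (‖pd1 (pd1^[a] f) x‖)
        have h2 := sq_nonneg (‖pd2 (pd1^[a] f) x‖)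
        have h3 := sq_nonneg (‖pd1 (pd1^[a + 1] f) x‖)
        have h4 := sq_nonneg (‖pd2 (pd1^[a + 1] f) x‖)
        unfold gradSq
        linarith)
      (l := 1) (by norm_num) (by norm_num) (by simpa using E2 a ha)
  have T3 : ∀ a < 7, ∀ l, 2 ≤ l → l + a ≤ 8 → ∀ m, l ≤ m →
      auxI m (pd1^[a] (pd2^[l] f)) ≤ K * E := fun a ha l hl hla m hlm =>
    aux_auxI_le hC₁ hρ (aux_pd1_it (aux_pd2_it hf l) a).continuous
      (H := fun x => ‖pd1^[a] (pd2^[l] f) x‖ ^ 2)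
      ((aux_pd1_it (aux_pd2_it hf l) a).continuous.norm.pow 2)
      (fun _ => le_rfl) (l := l) hlm (by omega) (E3 a ha l hl hla)
  have hg : ContDiff ℝ ∞ (pd1^[a] (pd2^[b] f)) := aux_pd1_it (aux_pd2_it hf b) a
  have fin : ∀ k ≤ 4, (∀ j ≤ k, auxI (0 + 2 * k) (pd2^[j] (pd1^[a] (pd2^[b] f))) ≤ K * E) →
      ∫ x in Oset, ‖pd1^[a] (pd2^[b] f) x‖ ^ 2 ≤ 288 ^ 4 * (K * E) := by
    intro k hk hj
    have h1 := aux_hardy_it k _ hg 0 (K * E) hj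
    have h2 : auxI 0 (pd1^[a] (pd2^[b] f)) = ∫ x in Oset, ‖pd1^[a] (pd2^[b] f) x‖ ^ 2 := by
      simp [auxI]
    rw [← h2]
    exact h1.trans (mul_le_mul_of_nonneg_right
      (pow_le_pow_right₀ (by norm_num) hk) (mul_nonneg hK E0))
  rcases Nat.lt_or_ge b 2 with hb | hb
  · refine fin 1 (by norm_num) ?_
    intro j hj
    interval_cases b
    · interval_cases j
      · rcases a with _ | a
        · exact T0
        · have := T1 a (by omega)
          rw [← Function.iterate_succ_apply' (f := pd1)] at this
          exact this
      · exact T2 a (by omega)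
    · interval_cases j
      · have := T2 a (by omega)
        have e := aux_comm2 hf a 1
        simp only [Function.iterate_one] at e
        rw [e] at this
        exact this
      · rw [aux_comm2 (aux_pd2_it hf 1), ← Function.iterate_add_apply]
        exact T3 a (by omega) 2 le_rfl (by omega) 2 le_rfl
  · refine fin b (by omega) ?_
    intro j hj
    rw [aux_comm2 (aux_pd2_it hf b), ← Function.iterate_add_apply]
    exact T3 a (by omega) (j + b) (by omega) (by omega) _ (by omega)

lemma aux_sobolev {C₁ C₂ : ℝ} (hC₁ : 0 < C₁) {ρ₀ : ℝ × ℝ → ℝ} (hρ : IsDensity C₁ C₂ ρ₀)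
    {v : ℝ → ℝ × ℝ → ℝ × ℝ} (hv : AuxST v) (t : ℝ) :
    ∑ θ ∈ Finset.range (4 + 1), ∫ x in Oset, ‖iteratedFDeriv ℝ θ (v t) x‖ ^ 2
      ≤ 6400 * 288 ^ 4 * (max 1 (1 / C₁)) ^ 8 * energy ρ₀ v t := by
  have E0 := (aux_energy_terms hC₁ hρ v t).1
  have hf : ContDiff ℝ ∞ (v t) := aux_ST_sec hv t
  set M := 288 ^ 4 * ((max 1 (1 / C₁)) ^ 8 * energy ρ₀ v t) with hM
  have hM0 : 0 ≤ M := by positivity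
  have h1 : ∀ θ ∈ Finset.range (4 + 1),
      ∫ x in Oset, ‖iteratedFDeriv ℝ θ (v t) x‖ ^ 2 ≤ 256 * (5 * M) := by
    intro θ hθ
    have hθ' : θ ≤ 4 := by have := Finset.mem_range.1 hθ; omega
    have cont : ∀ p : ℕ × ℕ, Continuous fun x => ‖pd1^[p.1] (pd2^[p.2] (v t)) x‖ ^ 2 := fun p =>
      (aux_pd1_it (aux_pd2_it hf p.2) p.1).continuous.norm.pow 2
    have cS : Continuous fun x => ∑ p ∈ Finset.HasAntidiagonal.antidiagonal θ,
        ‖pd1^[p.1] (pd2^[p.2] (v t)) x‖ ^ 2 := continuous_finsetSum _ fun p _ => cont p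
    have k1 : ∫ x in Oset, ‖iteratedFDeriv ℝ θ (v t) x‖ ^ 2 ≤ ∫ x in Oset, 4 ^ θ *
        ∑ p ∈ Finset.HasAntidiagonal.antidiagonal θ, ‖pd1^[p.1] (pd2^[p.2] (v t)) x‖ ^ 2 :=
      aux_mono ((aux_itF_smooth hf θ).continuous.norm.pow 2)
      (continuous_const.mul cS) (fun x _ => aux_Dn_sq hf θ x)
    rw [integral_const_mul, integral_finsetSum _ (fun p _ => aux_intO (cont p))] at k1
    have k2 : ∑ p ∈ Finset.HasAntidiagonal.antidiagonal θ,
        ∫ x in Oset, ‖pd1^[p.1] (pd2^[p.2] (v t)) x‖ ^ 2 ≤ 5 * M := by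
      refine (Finset.sum_le_card_nsmul _ _ M fun p hp => ?_).trans ?_
      · have := Finset.HasAntidiagonal.mem_antidiagonal.1 hp
        exact aux_key hC₁ hρ hv t (by omega)
      · rw [Finset.Nat.card_antidiagonal, nsmul_eq_mul]
        refine mul_le_mul_of_nonneg_right ?_ hM0
        have : ((θ + 1 : ℕ) : ℝ) ≤ ((5 : ℕ) : ℝ) := Nat.cast_le.2 (by omega)
        simpa using this
    refine k1.trans ?_
    have k3 : (4:ℝ) ^ θ ≤ 256 := by
      have := pow_le_pow_right₀ (by norm_num : (1:ℝ) ≤ 4) hθ'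
      norm_num at this; exact this
    exact mul_le_mul k3 k2 (Finset.sum_nonneg fun p _ =>
      integral_nonneg fun x => sq_nonneg _) (by norm_num)
  have h2 := Finset.sum_le_card_nsmul _ _ _ h1
  rw [Finset.card_range, nsmul_eq_mul] at h2
  refine h2.trans (le_of_eq ?_)
  rw [hM]; push_cast; ring

lemma aux_flow_final {C₁ C₂ : ℝ} (hC₁ : 0 < C₁) {ρ₀ : ℝ × ℝ → ℝ} (hρ : IsDensity C₁ C₂ ρ₀)
    {v : ℝ → ℝ × ℝ → ℝ × ℝ} (hv : AuxST v) {t : ℝ} (ht : 0 ≤ t) :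
    0 ≤ supEn ρ₀ v t ∧
    ∑ θ ∈ Finset.Icc 2 4, ∫ y in Oset, ‖iteratedFDeriv ℝ θ (flowMap v t) y‖ ^ 2
      ≤ 6400 * 288 ^ 4 * (max 1 (1 / C₁)) ^ 8 * (t * supEn ρ₀ v t) ^ 2 := by
  set R : ℝ := 6400 * 288 ^ 4 * (max 1 (1 / C₁)) ^ 8 with hR
  have hR0 : 0 ≤ R := by positivity
  have cE : Continuous fun s => Real.sqrt (energy ρ₀ v s) :=
    (aux_energy_cont (hρ.1 0).continuous hv).sqrt
  have bdd : BddAbove (Set.range fun s : Set.Icc (0:ℝ) t => Real.sqrt (energy ρ₀ v ↑s)) := by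
    have := (isCompact_Icc (a := (0:ℝ)) (b := t)).bddAbove_image cE.continuousOn
    rwa [Set.image_eq_range] at this
  have hle : ∀ s ∈ Set.Icc (0:ℝ) t, Real.sqrt (energy ρ₀ v s) ≤ supEn ρ₀ v t := fun s hs =>
    le_ciSup bdd ⟨s, hs⟩
  have hS0 : 0 ≤ supEn ρ₀ v t := (Real.sqrt_nonneg _).trans (hle 0 ⟨le_rfl, ht⟩)
  refine ⟨hS0, ?_⟩
  set S := supEn ρ₀ v t with hS
  have hEs : ∀ s ∈ Set.Icc (0:ℝ) t, energy ρ₀ v s ≤ S ^ 2 := fun s hs => by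
    have E0 := (aux_energy_terms hC₁ hρ v s).1
    rw [← Real.sq_sqrt E0]
    exact pow_le_pow_left₀ (Real.sqrt_nonneg _) (hle s hs) 2
  have cN : ∀ θ, Continuous fun s => ∫ x in Oset, ‖iteratedFDeriv ℝ θ (v s) x‖ ^ 2 := fun θ =>
    aux_parcont (g := fun s x => ‖iteratedFDeriv ℝ θ (v s) x‖ ^ 2) ((aux_norm_cont θ hv).pow 2)
  have h1 : ∑ θ ∈ Finset.Icc 2 4, ∫ y in Oset, ‖iteratedFDeriv ℝ θ (flowMap v t) y‖ ^ 2
      ≤ ∑ θ ∈ Finset.Icc 2 4,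
        t * ∫ s in (0:ℝ)..t, ∫ x in Oset, ‖iteratedFDeriv ℝ θ (v s) x‖ ^ 2 := by
    refine Finset.sum_le_sum fun θ hθ => ?_
    obtain ⟨n, rfl⟩ := Nat.exists_eq_add_of_le' (Finset.mem_Icc.1 hθ).1
    exact aux_flow_int hv ht n
  rw [← Finset.mul_sum, ← intervalIntegral.integral_finsetSum
    (fun θ _ => (cN θ).intervalIntegrable _ _)] at h1
  have h2 : ∫ s in (0:ℝ)..t, ∑ θ ∈ Finset.Icc 2 4, ∫ x in Oset, ‖iteratedFDeriv ℝ θ (v s) x‖ ^ 2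
      ≤ ∫ s in (0:ℝ)..t, R * S ^ 2 := by
    refine intervalIntegral.integral_mono_on ht ?_ (continuous_const.intervalIntegrable _ _) ?_
    · exact (continuous_finsetSum _ fun θ _ => cN θ).intervalIntegrable _ _
    · intro s hs
      refine le_trans ?_ ((aux_sobolev hC₁ hρ hv s).trans
        (mul_le_mul_of_nonneg_left (hEs s hs) hR0))
      refine Finset.sum_le_sum_of_subset_of_nonneg (fun i hi => ?_)
        fun _ _ _ => integral_nonneg fun x => sq_nonneg _
      have := Finset.mem_Icc.1 hi
      exact Finset.mem_range.2 (by omega)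
  rw [intervalIntegral.integral_const, smul_eq_mul, sub_zero] at h2
  refine h1.trans ((mul_le_mul_of_nonneg_left h2 ht).trans (le_of_eq ?_))
  ring


/-- (Lemma on consequences of the energy functional.)
`‖D²v(t)‖_{L^∞(Ω)} ≤ c₁‖v(t)‖_{H⁴(Ω)} ≤ c₁c₂ E(t,v)^{1/2}` and, for the flow map `η`,
`‖D²η(t)‖_{L^∞(Ω)} ≤ C‖D²η(t)‖_{H²(Ω)} ≤ C t sup_{0≤s≤t} E(s,v)^{1/2}`. -/
theorem stmt0 (C₁ C₂ : ℝ) (hC₁ : 0 < C₁) (hC₁₂ : C₁ ≤ C₂) :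
    ∃ c₁ > (0:ℝ), ∃ c₂ > (0:ℝ), ∃ C > (0:ℝ),
      ∀ ρ₀ : ℝ × ℝ → ℝ, IsDensity C₁ C₂ ρ₀ →
        ∀ T : ℝ, 0 ≤ T →
          ∀ v : ℝ → ℝ × ℝ → ℝ × ℝ, SmoothT v → PerT v →
            ∀ t ∈ Set.Icc (0:ℝ) T,
              (∀ x ∈ Oset, ‖iteratedFDeriv ℝ 2 (v t) x‖ ≤ c₁ * sobolevNorm 4 (v t)) ∧
              sobolevNorm 4 (v t) ≤ c₂ * Real.sqrt (energy ρ₀ v t) ∧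
              (∀ x ∈ Oset, ‖iteratedFDeriv ℝ 2 (flowMap v t) x‖ ≤
                C * Real.sqrt (∑ θ ∈ Finset.Icc 2 4,
                  ∫ y in Oset, ‖iteratedFDeriv ℝ θ (flowMap v t) y‖ ^ 2)) ∧
              Real.sqrt (∑ θ ∈ Finset.Icc 2 4,
                  ∫ y in Oset, ‖iteratedFDeriv ℝ θ (flowMap v t) y‖ ^ 2)
                ≤ C * t * supEn ρ₀ v t := by
  set R : ℝ := 6400 * 288 ^ 4 * (max 1 (1 / C₁)) ^ 8 with hR
  have hR0 : 0 < R := by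
    have : (0:ℝ) < max 1 (1 / C₁) := lt_of_lt_of_le one_pos (le_max_left _ _)
    positivity
  refine ⟨3, by norm_num, Real.sqrt R, Real.sqrt_pos.2 hR0, 3 + Real.sqrt R, by positivity, ?_⟩
  intro ρ₀ hρ T hT v hv _ t ht
  have hst : AuxST v := contDiff_infty.2 hv
  have hf := aux_ST_sec hst t
  refine ⟨?_, ?_, ?_, ?_⟩
  · intro x hx
    refine (aux_sob_main hf hx).trans ?_
    refine mul_le_mul_of_nonneg_left (Real.sqrt_le_sqrt ?_) (by norm_num)
    refine Finset.sum_le_sum_of_subset_of_nonneg (fun i hi => ?_)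
      fun _ _ _ => integral_nonneg fun x => sq_nonneg _
    have := Finset.mem_Icc.1 hi
    exact Finset.mem_range.2 (by omega)
  · rw [← Real.sqrt_mul hR0.le]
    exact Real.sqrt_le_sqrt (aux_sobolev hC₁ hρ hst t)
  · intro x hx
    refine (aux_sob_main (aux_flow_smooth hst t) hx).trans ?_
    exact mul_le_mul_of_nonneg_right (by linarith [Real.sqrt_nonneg R]) (Real.sqrt_nonneg _)
  · obtain ⟨hS, h⟩ := aux_flow_final hC₁ hρ hst ht.1
    have hts : 0 ≤ t * supEn ρ₀ v t := mul_nonneg ht.1 hS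
    refine (Real.sqrt_le_sqrt h).trans ?_
    rw [Real.sqrt_mul hR0.le, Real.sqrt_sq hts, mul_assoc]
    exact mul_le_mul_of_nonneg_right (by linarith) hts
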